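/- Upper bound in the high-temperature cut-off: if 0 ≤ β < 1, then lim_{γ→∞} limsup_{n→∞} d_n( n·log n / (2(1−β)) + γn ) = 0. -/

import Mathlib

open Filter Real

namespace CW

/-- Configurations of the Curie-Weiss model on `n` vertices:
`true` encodes spin `+1` and `false` encodes spin `-1`. -/
abbrev Config (n : ℕ) := Fin n → Bool

noncomputable section

/-- The spin (±1) at site `i`. -/
def spin {n : ℕ} (σ : Config n) (i : Fin n) : ℝ := if σ i then 1 else -1

/-- Normalized magnetization `S(σ) = n⁻¹ ∑ᵢ σ(i)`. -/
def mag {n : ℕ} (σ : Config n) : ℝ := (∑ i, spin σ i) / n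

/-- `p₊(s) = (1 + tanh(βs))/2`. -/
def pPlus (β s : ℝ) : ℝ := (1 + Real.tanh (β * s)) / 2

/-- One-step transition kernel of the Glauber dynamics for the Curie-Weiss
model: a uniformly chosen site `i` is refreshed, becoming `+1` with
probability `p₊(S(σ) - σ(i)/n)`. -/
def glauberKernel (β : ℝ) (n : ℕ) (σ η : Config n) : ℝ :=
  (1 / n) * ∑ i : Fin n,
    if ∀ j, j ≠ i → η j = σ j then
      (if η i then pPlus β (mag σ - spin σ i / n)
       else 1 - pPlus β (mag σ - spin σ i / n))
    else 0

/-- Law of the Glauber dynamics at time `t` started from `σ`. -/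
def glauberLaw (β : ℝ) (n : ℕ) : ℕ → Config n → Config n → ℝ
  | 0, σ, η => if η = σ then 1 else 0
  | t + 1, σ, η => ∑ τ : Config n, glauberLaw β n t σ τ * glauberKernel β n τ η

/-- The (normalized) exponent in the Curie-Weiss measure. -/
def cwExponent {n : ℕ} (β : ℝ) (σ : Config n) : ℝ :=
  (β / n) * ∑ i : Fin n, ∑ j : Fin n, if i < j then spin σ i * spin σ j else 0

/-- The Curie-Weiss (mean-field Ising) probability measure
`μ(σ) = Z(β)⁻¹ exp((β/n) ∑_{i<j} σ(i)σ(j))`. -/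
def cwMeasure (β : ℝ) (n : ℕ) (σ : Config n) : ℝ :=
  Real.exp (cwExponent β σ) / ∑ η : Config n, Real.exp (cwExponent β η)

/-- Total variation distance between two (discrete) distributions. -/
def tvDist {Ω : Type*} [Fintype Ω] (μ ν : Ω → ℝ) : ℝ :=
  (∑ x, |μ x - ν x|) / 2

/-- Worst-case total variation distance to stationarity at time `t`. -/
def glauberDist (β : ℝ) (n t : ℕ) : ℝ :=
  ⨆ σ : Config n, tvDist (glauberLaw β n t σ) (cwMeasure β n)

/-! ### The update probabilities -/

lemma monotone_id_sub_tanh : Monotone fun x : ℝ => x - Real.tanh x := by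
  have hd : ∀ x : ℝ, HasDerivAt (fun x : ℝ => x - Real.tanh x)
      (1 - (Real.cosh x * Real.cosh x - Real.sinh x * Real.sinh x) / Real.cosh x ^ 2) x := by
    intro x
    simp_rw [Real.tanh_eq_sinh_div_cosh]
    exact (hasDerivAt_id x).sub
      ((Real.hasDerivAt_sinh x).div (Real.hasDerivAt_cosh x) (Real.cosh_pos x).ne')
  refine monotone_of_deriv_nonneg (fun x => (hd x).differentiableAt) fun x => ?_
  rw [(hd x).deriv, sub_nonneg, div_le_one (by have := Real.cosh_pos x; positivity)]
  nlinarith [mul_self_nonneg (Real.sinh x)]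

lemma monotone_tanh : Monotone Real.tanh := by
  have hd : ∀ x : ℝ, HasDerivAt Real.tanh
      ((Real.cosh x * Real.cosh x - Real.sinh x * Real.sinh x) / Real.cosh x ^ 2) x := by
    intro x
    have : Real.tanh = fun x : ℝ => Real.sinh x / Real.cosh x :=
      funext Real.tanh_eq_sinh_div_cosh
    rw [this]
    exact (Real.hasDerivAt_sinh x).div (Real.hasDerivAt_cosh x) (Real.cosh_pos x).ne'
  refine monotone_of_deriv_nonneg (fun x => (hd x).differentiableAt) fun x => ?_
  rw [(hd x).deriv]
  have := Real.cosh_sq x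
  exact div_nonneg (by nlinarith) (sq_nonneg _)

/-- A lower bound for both update probabilities, uniform over `0 ≤ β ≤ 1`. -/
def minProb : ℝ := (1 - Real.tanh 1) / 2

lemma minProb_pos : 0 < minProb := by
  have : Real.tanh 1 < 1 := by
    rw [Real.tanh_eq_sinh_div_cosh, div_lt_one (Real.cosh_pos 1)]
    exact Real.sinh_lt_cosh 1
  unfold minProb
  linarith

lemma minProb_le_pPlus {β s : ℝ} (hβ0 : 0 ≤ β) (hβ1 : β ≤ 1) (hs : |s| ≤ 1) :
    minProb ≤ pPlus β s ∧ minProb ≤ 1 - pPlus β s := by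
  have h : |β * s| ≤ 1 := by
    rw [abs_mul, abs_of_nonneg hβ0]
    exact mul_le_one₀ hβ1 (abs_nonneg s) hs
  have h1 := monotone_tanh (abs_le.1 h).1
  have h2 := monotone_tanh (abs_le.1 h).2
  rw [Real.tanh_neg] at h1
  unfold minProb pPlus
  constructor <;> linarith

lemma pPlus_sub_pPlus_nonneg {β s t : ℝ} (hβ0 : 0 ≤ β) (h : t ≤ s) :
    0 ≤ pPlus β s - pPlus β t := by
  have := monotone_tanh (mul_le_mul_of_nonneg_left h hβ0)
  unfold pPlus
  linarith

lemma pPlus_sub_pPlus_le {β s t : ℝ} (hβ0 : 0 ≤ β) (h : t ≤ s) :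
    pPlus β s - pPlus β t ≤ β * (s - t) / 2 := by
  have := monotone_id_sub_tanh (mul_le_mul_of_nonneg_left h hβ0)
  unfold pPlus
  dsimp only at this
  linarith

/-- Probability that an update of site `i` produces a plus spin. -/
def siteProb (β : ℝ) {n : ℕ} (σ : Config n) (i : Fin n) : ℝ :=
  pPlus β (mag σ - spin σ i / n)

variable {n : ℕ}

lemma mag_sub_spin (σ : Config n) (i : Fin n) :
    mag σ - spin σ i / n = (∑ j ∈ Finset.univ.erase i, spin σ j) / n := by
  rw [mag, ← Finset.add_sum_erase _ _ (Finset.mem_univ i)]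
  ring

lemma abs_spin (σ : Config n) (i : Fin n) : |spin σ i| = 1 := by
  unfold spin
  split_ifs <;> simp

lemma abs_mag_sub_spin_le (σ : Config n) (i : Fin n) : |mag σ - spin σ i / n| ≤ 1 := by
  have hn : (0 : ℝ) < n := Nat.cast_pos.2 i.pos
  rw [mag_sub_spin, abs_div, abs_of_pos hn, div_le_one hn]
  refine (Finset.abs_sum_le_sum_abs _ _).trans ?_
  simp only [abs_spin, Finset.sum_const, nsmul_eq_mul, mul_one]
  exact_mod_cast (Finset.card_le_univ _).trans (by simp)

lemma minProb_le_siteProb {β : ℝ} (hβ0 : 0 ≤ β) (hβ1 : β ≤ 1) (σ : Config n) (i : Fin n) :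
    minProb ≤ siteProb β σ i ∧ minProb ≤ 1 - siteProb β σ i :=
  minProb_le_pPlus hβ0 hβ1 (abs_mag_sub_spin_le σ i)

@[simp] lemma siteProb_update_self (β : ℝ) (σ : Config n) (i : Fin n) (b : Bool) :
    siteProb β (Function.update σ i b) i = siteProb β σ i := by
  unfold siteProb
  rw [mag_sub_spin, mag_sub_spin]
  congr 2
  refine Finset.sum_congr rfl fun j hj => ?_
  rw [spin, spin, Function.update_of_ne (Finset.ne_of_mem_erase hj)]

lemma mag_update_true_sub_false (σ : Config n) {i j : Fin n} (h : i ≠ j) :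
    (mag (Function.update σ j true) - spin (Function.update σ j true) i / n)
      - (mag (Function.update σ j false) - spin (Function.update σ j false) i / n) = 2 / n := by
  rw [mag_sub_spin, mag_sub_spin, ← sub_div, ← Finset.sum_sub_distrib]
  rw [Finset.sum_eq_single_of_mem j (by simp [h.symm])]
  · norm_num [spin]
  · intro k _ hk
    simp [spin, Function.update_of_ne hk]

/-- Discrete influence of site `j` on the update probability at site `i`. -/
lemma siteProb_influence {β : ℝ} (hβ0 : 0 ≤ β) (σ : Config n) {i j : Fin n} (h : i ≠ j) :
    |siteProb β (Function.update σ j true) i - siteProb β (Function.update σ j false) i|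
      ≤ β / n := by
  have hd := mag_update_true_sub_false σ h
  have hn : (0 : ℝ) ≤ 2 / n := by positivity
  have hle := sub_nonneg.1 (hd.symm ▸ hn)
  unfold siteProb
  rw [abs_of_nonneg (pPlus_sub_pPlus_nonneg hβ0 hle)]
  refine (pPlus_sub_pPlus_le hβ0 hle).trans_eq ?_
  rw [hd]
  ring

/-! ### The Markov operator and discrete gradients -/

/-- Conditional expectation of `f` after refreshing site `i`. -/
def heatBath (β : ℝ) (i : Fin n) (f : Config n → ℝ) (σ : Config n) : ℝ :=
  siteProb β σ i * f (Function.update σ i true)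
    + (1 - siteProb β σ i) * f (Function.update σ i false)

/-- The Markov operator of the Glauber dynamics. -/
def markovOp (β : ℝ) (f : Config n → ℝ) (σ : Config n) : ℝ :=
  (1 / n) * ∑ i, heatBath β i f σ

/-- Discrete derivative of `f` at site `j`. -/
def siteDiff (j : Fin n) (f : Config n → ℝ) (σ : Config n) : ℝ :=
  f (Function.update σ j true) - f (Function.update σ j false)

/-- Squared length of the discrete gradient. -/
def gradSq (f : Config n → ℝ) (σ : Config n) : ℝ := ∑ j, siteDiff j f σ ^ 2

/-- The configuration with the spin at `j` reversed. -/
def spinFlip (σ : Config n) (j : Fin n) : Config n := Function.update σ j (!σ j)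

lemma siteDiff_heatBath_self (β : ℝ) (j : Fin n) (f : Config n → ℝ) (σ : Config n) :
    siteDiff j (heatBath β j f) σ = 0 := by
  simp [siteDiff, heatBath]

lemma siteDiff_heatBath (β : ℝ) {i j : Fin n} (h : i ≠ j) (f : Config n → ℝ) (σ : Config n) :
    siteDiff j (heatBath β i f) σ = heatBath β i (siteDiff j f) σ
      + (siteProb β (Function.update σ j true) i - siteProb β (Function.update σ j false) i)
        * siteDiff i f (spinFlip σ j) := by
  have hc : ∀ b c, Function.update (Function.update σ i b) j c
      = Function.update (Function.update σ j c) i b := fun b c => Function.update_comm h b c σ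
  have hs : siteProb β σ i = siteProb β (Function.update σ j (σ j)) i := by
    rw [Function.update_eq_self]
  simp only [siteDiff, heatBath, spinFlip, hc, hs]
  cases σ j <;> simp <;> ring

lemma sum_kernel_mul (β : ℝ) (f : Config n → ℝ) (σ : Config n) :
    ∑ η, glauberKernel β n σ η * f η = markovOp β f σ := by
  have key : ∀ i : Fin n, ∑ η : Config n, (if ∀ j, j ≠ i → η j = σ j then
      (if η i then pPlus β (mag σ - spin σ i / n)
       else 1 - pPlus β (mag σ - spin σ i / n)) else 0) * f η = heatBath β i f σ := by
    intro i
    have hne : Function.update σ i true ≠ Function.update σ i false := by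
      intro h
      simpa using congrFun h i
    rw [← Finset.sum_subset (Finset.subset_univ
      {Function.update σ i true, Function.update σ i false}), Finset.sum_pair hne]
    · have h1 : ∀ b, ∀ j, j ≠ i → Function.update σ i b j = σ j :=
        fun b j hj => Function.update_of_ne hj _ _
      rw [if_pos (h1 true), if_pos (h1 false)]
      simp [heatBath, siteProb]
    · intro η _ hη
      rw [if_neg, zero_mul]
      intro hall
      apply hη
      have : η = Function.update σ i (η i) := by
        funext j
        by_cases hj : j = i
        · subst hj; simp
        · rw [Function.update_of_ne hj, hall j hj]
      rw [this]
      cases η i <;> simp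
  simp only [glauberKernel, mul_assoc, ← Finset.mul_sum, markovOp]
  congr 1
  simp only [Finset.sum_mul]
  rw [Finset.sum_comm]
  exact Finset.sum_congr rfl fun i _ => key i

lemma sum_law_mul (β : ℝ) (t : ℕ) (f : Config n → ℝ) (σ : Config n) :
    ∑ η, glauberLaw β n t σ η * f η = (markovOp β)^[t] f σ := by
  induction t generalizing f with
  | zero => simp [glauberLaw]
  | succ t ih =>
    rw [Function.iterate_succ_apply, ← ih]
    simp only [glauberLaw, ← sum_kernel_mul, Finset.sum_mul, Finset.mul_sum, mul_assoc]
    rw [Finset.sum_comm]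

section Positivity

lemma gradSq_nonneg (f : Config n → ℝ) (σ : Config n) : 0 ≤ gradSq f σ :=
  Finset.sum_nonneg fun _ _ => sq_nonneg _

variable {β : ℝ} (hβ0 : 0 ≤ β) (hβ1 : β ≤ 1)

lemma markovOp_linear (β : ℝ) (a b : ℝ) (f g : Config n → ℝ) (σ : Config n) :
    markovOp β (fun τ => a * f τ + b * g τ) σ = a * markovOp β f σ + b * markovOp β g σ := by
  simp only [markovOp, heatBath, Finset.mul_sum, ← Finset.sum_add_distrib]
  exact Finset.sum_congr rfl fun i _ => by ring

lemma markovOp_const (β c : ℝ) (hn : 0 < n) :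
    markovOp β (fun _ : Config n => c) = fun _ => c := by
  funext σ
  have : (n : ℝ) ≠ 0 := by positivity
  have h : ∀ i : Fin n, heatBath β i (fun _ : Config n => c) σ = c := fun i => by
    simp only [heatBath]
    ring
  simp only [markovOp, h, Finset.sum_const, Finset.card_univ, Fintype.card_fin, nsmul_eq_mul]
  field_simp

include hβ0 hβ1

lemma siteProb_pos (σ : Config n) (i : Fin n) : 0 < siteProb β σ i :=
  minProb_pos.trans_le (minProb_le_siteProb hβ0 hβ1 σ i).1

lemma one_sub_siteProb_pos (σ : Config n) (i : Fin n) : 0 < 1 - siteProb β σ i :=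
  minProb_pos.trans_le (minProb_le_siteProb hβ0 hβ1 σ i).2

lemma heatBath_mono (i : Fin n) {f g : Config n → ℝ} (h : ∀ σ, f σ ≤ g σ) (σ : Config n) :
    heatBath β i f σ ≤ heatBath β i g σ :=
  add_le_add
    (mul_le_mul_of_nonneg_left (h _) (siteProb_pos hβ0 hβ1 σ i).le)
    (mul_le_mul_of_nonneg_left (h _) (one_sub_siteProb_pos hβ0 hβ1 σ i).le)

lemma markovOp_mono {f g : Config n → ℝ} (h : ∀ σ, f σ ≤ g σ) (σ : Config n) :
    markovOp β f σ ≤ markovOp β g σ :=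
  mul_le_mul_of_nonneg_left
    (Finset.sum_le_sum fun i _ => heatBath_mono hβ0 hβ1 i h σ) (by positivity)

lemma markovOp_iterate_mono (t : ℕ) {f g : Config n → ℝ} (h : ∀ σ, f σ ≤ g σ) (σ : Config n) :
    (markovOp β)^[t] f σ ≤ (markovOp β)^[t] g σ := by
  induction t generalizing f g with
  | zero => exact h σ
  | succ t ih => exact ih (markovOp_mono hβ0 hβ1 h)

omit hβ0 hβ1 in
lemma markovOp_iterate_linear (t : ℕ) (a b : ℝ) (f g : Config n → ℝ) (σ : Config n) :
    (markovOp β)^[t] (fun τ => a * f τ + b * g τ) σ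
      = a * (markovOp β)^[t] f σ + b * (markovOp β)^[t] g σ := by
  induction t generalizing f g with
  | zero => rfl
  | succ t ih =>
    simp only [Function.iterate_succ_apply]
    rw [← ih, funext (markovOp_linear β a b f g)]

omit hβ0 hβ1 in
lemma heatBath_sq_sub_sq (i : Fin n) (f : Config n → ℝ) (σ : Config n) :
    heatBath β i (fun τ => f τ ^ 2) σ - heatBath β i f σ ^ 2
      = siteProb β σ i * (1 - siteProb β σ i) * siteDiff i f σ ^ 2 := by
  simp only [heatBath, siteDiff]
  ring

lemma sq_heatBath_le (i : Fin n) (f : Config n → ℝ) (σ : Config n) :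
    heatBath β i f σ ^ 2 ≤ heatBath β i (fun τ => f τ ^ 2) σ := by
  have h1 := siteProb_pos hβ0 hβ1 σ i
  have h2 := one_sub_siteProb_pos hβ0 hβ1 σ i
  rw [← sub_nonneg, heatBath_sq_sub_sq]
  positivity

/-- One-step variance dominates the squared gradient. -/
lemma gradSq_le_variance (hn : 0 < n) (f : Config n → ℝ) (σ : Config n) :
    minProb ^ 2 / n * gradSq f σ ≤ markovOp β (fun τ => f τ ^ 2) σ - markovOp β f σ ^ 2 := by
  have hn' : (0 : ℝ) < n := by exact_mod_cast hn
  have hk := minProb_pos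
  have hcs : markovOp β f σ ^ 2 ≤ 1 / n * ∑ i, heatBath β i f σ ^ 2 := by
    have := sq_sum_le_card_mul_sum_sq (s := Finset.univ) (f := fun i => heatBath β i f σ)
    rw [Finset.card_univ, Fintype.card_fin] at this
    calc markovOp β f σ ^ 2 = (1 / n) ^ 2 * (∑ i, heatBath β i f σ) ^ 2 := by
          rw [markovOp, mul_pow]
      _ ≤ (1 / n) ^ 2 * (n * ∑ i, heatBath β i f σ ^ 2) := by gcongr
      _ = _ := by field_simp
  have hvar : minProb ^ 2 / n * gradSq f σ
      ≤ 1 / n * ∑ i, (heatBath β i (fun τ => f τ ^ 2) σ - heatBath β i f σ ^ 2) := by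
    rw [gradSq, div_mul_eq_mul_div, one_div_mul_eq_div, Finset.mul_sum]
    gcongr with i
    rw [heatBath_sq_sub_sq, sq minProb]
    obtain ⟨h1, h2⟩ := minProb_le_siteProb hβ0 hβ1 σ i
    gcongr
    linarith
  rw [Finset.sum_sub_distrib, mul_sub] at hvar
  simp only [markovOp] at *
  linarith

/-- A uniformly random spin reversal is dominated by the Glauber dynamics. -/
lemma sum_flip_le_markovOp (hn : 0 < n) (h : Config n → ℝ) (hh : ∀ σ, 0 ≤ h σ) (σ : Config n) :
    ∑ j, h (spinFlip σ j) ≤ n / minProb * markovOp β h σ := by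
  have hn' : (0 : ℝ) < n := by exact_mod_cast hn
  have hk := minProb_pos
  have hmul : n / minProb * markovOp β h σ = ∑ i, heatBath β i h σ / minProb := by
    rw [markovOp, ← Finset.sum_div]
    field_simp
  rw [hmul]
  refine Finset.sum_le_sum fun j _ => ?_
  rw [le_div_iff₀ hk, mul_comm]
  obtain ⟨h1, h2⟩ := minProb_le_siteProb hβ0 hβ1 σ j
  have ht := hh (Function.update σ j true)
  have hf := hh (Function.update σ j false)
  unfold spinFlip heatBath
  cases σ j
  · simp only [Bool.not_false]
    nlinarith [mul_nonneg (hk.le.trans h2) hf]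
  · simp only [Bool.not_true]
    nlinarith [mul_nonneg (hk.le.trans h1) ht]

omit hβ0 hβ1 in
lemma siteDiff_markovOp (j : Fin n) (f : Config n → ℝ) (σ : Config n) :
    siteDiff j (markovOp β f) σ
      = (1 / n) * ∑ i ∈ Finset.univ.erase j, heatBath β i (siteDiff j f) σ
        + (1 / n) * ∑ i ∈ Finset.univ.erase j,
          (siteProb β (Function.update σ j true) i - siteProb β (Function.update σ j false) i)
            * siteDiff i f (spinFlip σ j) := by
  have h : siteDiff j (markovOp β f) σ = (1 / n) * ∑ i, siteDiff j (heatBath β i f) σ := by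
    simp only [siteDiff, markovOp, Finset.sum_sub_distrib, mul_sub]
  rw [h, ← mul_add, ← Finset.sum_add_distrib, ← Finset.add_sum_erase _ _ (Finset.mem_univ j),
    siteDiff_heatBath_self, zero_add]
  congr 1
  exact Finset.sum_congr rfl fun i hi => siteDiff_heatBath β (Finset.ne_of_mem_erase hi) f σ

/-- Expansion constant of the squared gradient under one step of the dynamics. -/
def gradConst : ℝ := 1 + 2 / minProb

lemma sq_siteDiff_markovOp_le (hn : 0 < n) (j : Fin n) (f : Config n → ℝ) (σ : Config n) :
    siteDiff j (markovOp β f) σ ^ 2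
      ≤ (1 + 1 / n) * markovOp β (fun τ => siteDiff j f τ ^ 2) σ
        + 2 / n ^ 2 * gradSq f (spinFlip σ j) := by
  have hn' : (1 : ℝ) ≤ n := by exact_mod_cast hn
  have hn0 : (0 : ℝ) < n := by positivity
  rw [siteDiff_markovOp]
  set x := ∑ i ∈ Finset.univ.erase j, heatBath β i (siteDiff j f) σ with hx
  set y := ∑ i ∈ Finset.univ.erase j,
    (siteProb β (Function.update σ j true) i - siteProb β (Function.update σ j false) i)
      * siteDiff i f (spinFlip σ j) with hy
  have hcard : ((Finset.univ.erase j).card : ℝ) ≤ n := by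
    exact_mod_cast (Finset.card_le_univ _).trans (by simp)
  have hxle : x ^ 2 ≤ n ^ 2 * markovOp β (fun τ => siteDiff j f τ ^ 2) σ := by
    calc x ^ 2 ≤ (Finset.univ.erase j).card
          * ∑ i ∈ Finset.univ.erase j, heatBath β i (siteDiff j f) σ ^ 2 :=
          sq_sum_le_card_mul_sum_sq
      _ ≤ n * ∑ i, heatBath β i (siteDiff j f) σ ^ 2 := by
          gcongr ?_ * ?_
          exact Finset.sum_le_univ_sum_of_nonneg fun i => sq_nonneg _
      _ ≤ n * ∑ i, heatBath β i (fun τ => siteDiff j f τ ^ 2) σ := by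
          gcongr with i
          exact sq_heatBath_le hβ0 hβ1 i _ σ
      _ = _ := by
          rw [markovOp]
          field_simp
  have hyle : y ^ 2 ≤ 1 / n * gradSq f (spinFlip σ j) := by
    calc y ^ 2 ≤ (Finset.univ.erase j).card * ∑ i ∈ Finset.univ.erase j,
          ((siteProb β (Function.update σ j true) i - siteProb β (Function.update σ j false) i)
            * siteDiff i f (spinFlip σ j)) ^ 2 := sq_sum_le_card_mul_sum_sq
      _ ≤ n * ∑ i ∈ Finset.univ.erase j, (1 / n) ^ 2 * siteDiff i f (spinFlip σ j) ^ 2 := by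
          gcongr with i hi
          rw [mul_pow]
          gcongr ?_ * _
          rw [sq_le_sq, abs_of_nonneg (by positivity : (0 : ℝ) ≤ 1 / n)]
          refine (siteProb_influence hβ0 σ (Finset.ne_of_mem_erase hi)).trans ?_
          gcongr
      _ ≤ n * ∑ i, (1 / n) ^ 2 * siteDiff i f (spinFlip σ j) ^ 2 := by
          gcongr ?_ * ?_
          exact Finset.sum_le_univ_sum_of_nonneg fun i =>
            mul_nonneg (sq_nonneg _) (sq_nonneg _)
      _ = _ := by
          rw [← Finset.mul_sum, gradSq]
          field_simp
  have hyoung : (1 / n * x + 1 / n * y) ^ 2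
      ≤ (1 + 1 / n) * (1 / n ^ 2 * x ^ 2) + (1 + n) * (1 / n ^ 2 * y ^ 2) := by
    have : (1 + 1 / n) * (1 / n ^ 2 * x ^ 2) + (1 + n) * (1 / n ^ 2 * y ^ 2)
        - (1 / n * x + 1 / n * y) ^ 2 = 1 / n * (1 / n * x - y) ^ 2 := by
      field_simp
      ring
    have h2 : 0 ≤ 1 / (n : ℝ) * (1 / n * x - y) ^ 2 := by positivity
    linarith
  have hg := gradSq_nonneg f (spinFlip σ j)
  refine hyoung.trans (add_le_add ?_ ?_)
  · gcongr
    rw [one_div_mul_eq_div, div_le_iff₀ (by positivity), mul_comm]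
    exact hxle
  · calc (1 + (n : ℝ)) * (1 / n ^ 2 * y ^ 2)
        ≤ (n + n) * (1 / n ^ 2 * (1 / n * gradSq f (spinFlip σ j))) := by gcongr
      _ = _ := by
          field_simp
          ring

lemma gradSq_markovOp_le (hn : 0 < n) (f : Config n → ℝ) (σ : Config n) :
    gradSq (markovOp β f) σ ≤ (1 + gradConst / n) * markovOp β (gradSq f) σ := by
  have hn0 : (0 : ℝ) < n := by exact_mod_cast hn
  have hk := minProb_pos
  have hsum : ∑ j, markovOp β (fun τ => siteDiff j f τ ^ 2) σ = markovOp β (gradSq f) σ := by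
    simp only [markovOp, heatBath, gradSq]
    rw [← Finset.mul_sum, Finset.sum_comm]
    simp only [Finset.mul_sum, ← Finset.sum_add_distrib]
  have hflip := sum_flip_le_markovOp hβ0 hβ1 hn _ (gradSq_nonneg f) σ
  calc gradSq (markovOp β f) σ
      ≤ ∑ j, ((1 + 1 / n) * markovOp β (fun τ => siteDiff j f τ ^ 2) σ
        + 2 / n ^ 2 * gradSq f (spinFlip σ j)) :=
        Finset.sum_le_sum fun j _ => sq_siteDiff_markovOp_le hβ0 hβ1 hn j f σ
    _ = (1 + 1 / n) * markovOp β (gradSq f) σ + 2 / n ^ 2 * ∑ j, gradSq f (spinFlip σ j) := by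
        rw [Finset.sum_add_distrib, ← Finset.mul_sum, ← Finset.mul_sum, hsum]
    _ ≤ (1 + 1 / n) * markovOp β (gradSq f) σ
        + 2 / n ^ 2 * (n / minProb * markovOp β (gradSq f) σ) := by gcongr
    _ = _ := by
        rw [gradConst]
        field_simp
        ring

/-- Reverse Poincaré inequality for the dynamics run for `m + 1` steps. -/
lemma gradSq_iterate_le_variance (hn : 0 < n) (m : ℕ) (f : Config n → ℝ) (σ : Config n) :
    minProb ^ 2 / n * (m + 1) * gradSq ((markovOp β)^[m] f) σ
      ≤ (1 + gradConst / n) ^ m * ((markovOp β)^[m + 1] (fun τ => f τ ^ 2) σ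
        - (markovOp β)^[m + 1] f σ ^ 2) := by
  have hn0 : (0 : ℝ) < n := by exact_mod_cast hn
  have hk := minProb_pos
  have hM : 1 ≤ 1 + gradConst / n := by
    have : 0 < gradConst := by unfold gradConst; positivity
    simp only [le_add_iff_nonneg_right]
    positivity
  set M := 1 + gradConst / n with hMdef
  set c := minProb ^ 2 / n with hc
  have hc0 : 0 ≤ c := by positivity
  have hcomm : ∀ (m : ℕ) (f : Config n → ℝ) (σ : Config n),
      gradSq ((markovOp β)^[m] f) σ ≤ M ^ m * (markovOp β)^[m] (gradSq f) σ := by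
    intro m
    induction m with
    | zero => intro f σ; simp
    | succ m ih =>
      intro f σ
      have h1 := ih (markovOp β f) σ
      have h2 := markovOp_iterate_mono hβ0 hβ1 m (gradSq_markovOp_le hβ0 hβ1 hn f) σ
      have h3 := markovOp_iterate_linear (β := β) m M 0 (markovOp β (gradSq f)) 0 σ
      simp only [Pi.zero_apply, zero_mul, add_zero] at h3
      rw [h3] at h2
      simp only [Function.iterate_succ_apply]
      calc _ ≤ _ := h1
        _ ≤ M ^ m * (M * (markovOp β)^[m] (markovOp β (gradSq f)) σ) := by gcongr
        _ = _ := by ring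
  induction m generalizing f with
  | zero => simpa using gradSq_le_variance hβ0 hβ1 hn f σ
  | succ m ih =>
    have h1 := ih (markovOp β f)
    have h2 := markovOp_iterate_mono hβ0 hβ1 (m + 1) (gradSq_le_variance hβ0 hβ1 hn f) σ
    have h3 := markovOp_iterate_linear (β := β) (m + 1) c 0 (gradSq f) 0 σ
    have h4 := markovOp_iterate_linear (β := β) (m + 1) 1 (-1) (markovOp β fun τ => f τ ^ 2)
      (fun τ => markovOp β f τ ^ 2) σ
    simp only [Pi.zero_apply, zero_mul, add_zero, one_mul, neg_mul, ← sub_eq_add_neg] at h3 h4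
    rw [← hc, h3, h4] at h2
    have h5 := hcomm (m + 1) f σ
    rw [Function.iterate_succ_apply] at h5 ⊢
    rw [Function.iterate_succ_apply _ (m + 1), Function.iterate_succ_apply _ (m + 1)]
    set G := gradSq ((markovOp β)^[m] (markovOp β f)) σ
    set A := (markovOp β)^[m + 1] (fun τ => markovOp β f τ ^ 2) σ
      - (markovOp β)^[m + 1] (markovOp β f) σ ^ 2 with hA
    have hG : 0 ≤ G := gradSq_nonneg _ _
    have hA0 : 0 ≤ A := by
      have : 0 ≤ M ^ m * A := le_trans (by positivity) h1
      exact nonneg_of_mul_nonneg_right this (by positivity)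
    have h6 : M ^ m * A ≤ M ^ (m + 1) * A := by
      gcongr
      exact m.le_succ
    have h7 := mul_le_mul_of_nonneg_left h2 (by positivity : 0 ≤ M ^ (m + 1))
    have h8 := mul_le_mul_of_nonneg_left h5 hc0
    push_cast
    linarith

end Positivity
/-! ### Lipschitz contraction -/

section Contraction

variable {β : ℝ} (hβ0 : 0 ≤ β) (hβ1 : β ≤ 1)

lemma abs_sub_le_sum_of_siteDiff_le {f : Config n → ℝ} {ℓ : Fin n → ℝ}
    (h : ∀ j σ, |siteDiff j f σ| ≤ ℓ j) (σ τ : Config n) : |f σ - f τ| ≤ ∑ j, ℓ j := by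
  have hℓ : ∀ j, 0 ≤ ℓ j := fun j => (abs_nonneg _).trans (h j σ)
  have hstep : ∀ (j : Fin n) (σ : Config n) (b c : Bool),
      |f (Function.update σ j b) - f (Function.update σ j c)| ≤ ℓ j := by
    intro j σ b c
    cases b <;> cases c
    · simpa using hℓ j
    · rw [abs_sub_comm]; exact h j σ
    · exact h j σ
    · simpa using hℓ j
  have key : ∀ (s : Finset (Fin n)) (σ τ : Config n), (∀ j ∉ s, σ j = τ j) →
      |f σ - f τ| ≤ ∑ j ∈ s, ℓ j := by
    intro s
    induction s using Finset.induction_on with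
    | empty =>
      intro σ τ hστ
      rw [show σ = τ from funext fun j => hστ j (Finset.notMem_empty j)]
      simp
    | insert i s hi ih =>
      intro σ τ hστ
      rw [Finset.sum_insert hi]
      have h1 := hstep i σ (σ i) (τ i)
      rw [Function.update_eq_self] at h1
      have h2 := ih (Function.update σ i (τ i)) τ (by
        intro j hj
        by_cases hji : j = i
        · subst hji; simp
        · rw [Function.update_of_ne hji]
          exact hστ j (by simp [hji, hj]))
      exact (abs_sub_le _ _ _).trans (add_le_add h1 h2)
  exact key Finset.univ σ τ (by simp)

include hβ0 hβ1

lemma abs_heatBath_le {f : Config n → ℝ} {c : ℝ} (h : ∀ σ, |f σ| ≤ c) (i : Fin n)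
    (σ : Config n) : |heatBath β i f σ| ≤ c := by
  have h1 := siteProb_pos hβ0 hβ1 σ i
  have h2 := one_sub_siteProb_pos hβ0 hβ1 σ i
  obtain ⟨ha, hb⟩ := abs_le.1 (h (Function.update σ i true))
  obtain ⟨hc, hd⟩ := abs_le.1 (h (Function.update σ i false))
  rw [heatBath, abs_le]
  constructor <;> nlinarith

lemma exists_siteDiff_markovOp_le (hn : 0 < n) {f : Config n → ℝ} {ℓ : Fin n → ℝ}
    (h : ∀ j σ, |siteDiff j f σ| ≤ ℓ j) :
    ∃ ℓ' : Fin n → ℝ, (∀ j σ, |siteDiff j (markovOp β f) σ| ≤ ℓ' j) ∧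
      ∑ j, ℓ' j = (1 - (1 - β) / n) * ∑ j, ℓ j := by
  have hn0 : (0 : ℝ) < n := by exact_mod_cast hn
  have hℓ : ∀ j, 0 ≤ ℓ j := fun j => (abs_nonneg _).trans (h j fun _ => true)
  refine ⟨fun j => (1 - 1 / n) * ℓ j + β / n ^ 2 * ∑ i, ℓ i, fun j σ => ?_, ?_⟩
  · have hcard : ((Finset.univ.erase j).card : ℝ) = n - 1 := by
      rw [Finset.card_erase_of_mem (Finset.mem_univ j), Finset.card_univ, Fintype.card_fin,
        Nat.cast_sub (by omega), Nat.cast_one]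
    rw [siteDiff_markovOp]
    refine (abs_add_le _ _).trans (add_le_add ?_ ?_)
    · rw [abs_mul, abs_of_pos (by positivity : (0 : ℝ) < 1 / n)]
      calc 1 / (n : ℝ) * |∑ i ∈ Finset.univ.erase j, heatBath β i (siteDiff j f) σ|
          ≤ 1 / n * ∑ i ∈ Finset.univ.erase j, ℓ j := by
            gcongr
            exact (Finset.abs_sum_le_sum_abs _ _).trans
              (Finset.sum_le_sum fun i _ => abs_heatBath_le hβ0 hβ1 (h j) i σ)
        _ = (1 - 1 / n) * ℓ j := by
            rw [Finset.sum_const, nsmul_eq_mul, hcard]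
            field_simp
    · rw [abs_mul, abs_of_pos (by positivity : (0 : ℝ) < 1 / n)]
      calc 1 / (n : ℝ) * |∑ i ∈ Finset.univ.erase j,
            (siteProb β (Function.update σ j true) i - siteProb β (Function.update σ j false) i)
              * siteDiff i f (spinFlip σ j)|
          ≤ 1 / n * ∑ i ∈ Finset.univ.erase j, β / n * ℓ i := by
            gcongr
            refine (Finset.abs_sum_le_sum_abs _ _).trans (Finset.sum_le_sum fun i hi => ?_)
            rw [abs_mul]
            exact mul_le_mul (siteProb_influence hβ0 σ (Finset.ne_of_mem_erase hi)) (h i _)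
              (abs_nonneg _) (by positivity)
        _ ≤ 1 / n * ∑ i, β / n * ℓ i := by
            gcongr ?_ * ?_
            exact Finset.sum_le_univ_sum_of_nonneg fun i =>
              mul_nonneg (by positivity) (hℓ i)
        _ = β / n ^ 2 * ∑ i, ℓ i := by
            rw [← Finset.mul_sum]
            field_simp
  · rw [Finset.sum_add_distrib, ← Finset.mul_sum, Finset.sum_const, Finset.card_univ,
      Fintype.card_fin, nsmul_eq_mul]
    field_simp
    ring

lemma abs_iterate_sub_le (hn : 0 < n) (t : ℕ) {f : Config n → ℝ} {ℓ : Fin n → ℝ}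
    (h : ∀ j σ, |siteDiff j f σ| ≤ ℓ j) (σ τ : Config n) :
    |(markovOp β)^[t] f σ - (markovOp β)^[t] f τ| ≤ (1 - (1 - β) / n) ^ t * ∑ j, ℓ j := by
  induction t generalizing f ℓ with
  | zero => simpa using abs_sub_le_sum_of_siteDiff_le h σ τ
  | succ t ih =>
    obtain ⟨ℓ', hb, hsum⟩ := exists_siteDiff_markovOp_le hβ0 hβ1 hn h
    have := ih hb
    rwa [hsum, ← mul_assoc, ← pow_succ] at this

end Contraction

/-! ### Smoothing of symmetric functions -/

section Smoothing

/-- Bound for the squared gradient of a function regularised by order `n` steps. -/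
def smoothConst : ℝ := Real.exp gradConst / minProb ^ 2

lemma gradSq_iterate_le {β : ℝ} (hβ0 : 0 ≤ β) (hβ1 : β ≤ 1) {m : ℕ} (hm : m + 1 = n)
    {f : Config n → ℝ} (hf : ∀ σ, |f σ| ≤ 1) (σ : Config n) :
    gradSq ((markovOp β)^[m] f) σ ≤ smoothConst := by
  have hn : 0 < n := by omega
  have hn0 : (0 : ℝ) < n := by exact_mod_cast hn
  have hk := minProb_pos
  have hgc : 0 < gradConst := by unfold gradConst; positivity
  have h := gradSq_iterate_le_variance hβ0 hβ1 hn m f σ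
  have hc : minProb ^ 2 / n * ((m : ℝ) + 1) = minProb ^ 2 := by
    rw [← Nat.cast_succ, Nat.succ_eq_add_one, hm]
    field_simp
  have hone : (markovOp β)^[m + 1] (fun _ : Config n => (1 : ℝ)) = fun _ => 1 :=
    Function.iterate_fixed (markovOp_const β 1 hn) _
  have hv : (markovOp β)^[m + 1] (fun τ => f τ ^ 2) σ - (markovOp β)^[m + 1] f σ ^ 2 ≤ 1 := by
    have := markovOp_iterate_mono hβ0 hβ1 (m + 1) (f := fun τ => f τ ^ 2) (g := fun _ => 1)
      (fun τ => (sq_le_one_iff_abs_le_one _).2 (hf τ)) σ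
    rw [hone] at this
    have := sq_nonneg ((markovOp β)^[m + 1] f σ)
    linarith
  have hpow : (1 + gradConst / n) ^ m ≤ Real.exp gradConst := by
    calc (1 + gradConst / n) ^ m ≤ Real.exp (gradConst / n) ^ m := by
          gcongr
          rw [add_comm]
          exact Real.add_one_le_exp _
      _ = Real.exp (m * (gradConst / n)) := (Real.exp_nat_mul _ _).symm
      _ ≤ Real.exp gradConst := by
          rw [Real.exp_le_exp, mul_div_assoc', div_le_iff₀ hn0, mul_comm]
          gcongr
          omega
  rw [hc] at h
  rw [smoothConst, le_div_iff₀ (by positivity), mul_comm]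
  calc _ ≤ _ := h
    _ ≤ (1 + gradConst / n) ^ m * 1 := by gcongr
    _ ≤ _ := by rwa [mul_one]

lemma mag_comp_equiv (e : Equiv.Perm (Fin n)) (σ : Config n) : mag (σ ∘ e) = mag σ := by
  unfold mag
  congr 1
  exact Equiv.sum_comp e (spin σ)

lemma heatBath_comp_equiv (β : ℝ) (e : Equiv.Perm (Fin n)) (i : Fin n) (f : Config n → ℝ)
    (σ : Config n) :
    heatBath β i (fun τ => f (τ ∘ e)) σ = heatBath β (e.symm i) f (σ ∘ e) := by
  have hp : siteProb β (σ ∘ e) (e.symm i) = siteProb β σ i := by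
    simp [siteProb, mag_comp_equiv, spin]
  simp only [heatBath, hp, Function.update_comp_equiv]

lemma markovOp_comp_equiv (β : ℝ) (e : Equiv.Perm (Fin n)) (f : Config n → ℝ) (σ : Config n) :
    markovOp β (fun τ => f (τ ∘ e)) σ = markovOp β f (σ ∘ e) := by
  simp only [markovOp, heatBath_comp_equiv]
  rw [Equiv.sum_comp e.symm fun i => heatBath β i f (σ ∘ e)]

lemma markovOp_iterate_comp_equiv (β : ℝ) (e : Equiv.Perm (Fin n)) (t : ℕ) (f : Config n → ℝ)
    (σ : Config n) :
    (markovOp β)^[t] (fun τ => f (τ ∘ e)) σ = (markovOp β)^[t] f (σ ∘ e) := by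
  induction t generalizing f with
  | zero => rfl
  | succ t ih =>
    rw [Function.iterate_succ_apply, Function.iterate_succ_apply, ← ih,
      funext (markovOp_comp_equiv β e f)]

lemma sq_siteDiff_eq_flip (j : Fin n) (f : Config n → ℝ) (σ : Config n) :
    siteDiff j f σ ^ 2 = (f (spinFlip σ j) - f σ) ^ 2 := by
  have : f σ = f (Function.update σ j (σ j)) := by rw [Function.update_eq_self]
  rw [this, siteDiff, spinFlip]
  cases σ j <;> simp
  ring

lemma siteDiff_flip (j : Fin n) (f : Config n → ℝ) (σ : Config n) :
    siteDiff j f (spinFlip σ j) = siteDiff j f σ := by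
  simp [siteDiff, spinFlip]

lemma comp_swap_of_eq {σ : Config n} {i j : Fin n} (h : σ i = σ j) :
    σ ∘ Equiv.swap i j = σ := by
  funext k
  rw [Function.comp_apply, Equiv.swap_apply_def]
  split_ifs with h1 h2
  · rw [h1, h]
  · rw [h2, h]
  · rfl

lemma flip_comp_swap {σ : Config n} {i j : Fin n} (h : σ i = σ j) :
    spinFlip σ i ∘ Equiv.swap i j = spinFlip σ j := by
  rw [spinFlip, Function.update_comp_equiv, comp_swap_of_eq h, Equiv.symm_swap,
    Equiv.swap_apply_left, h, spinFlip]

/-- A function with bounded squared gradient that is symmetric over the class `A` has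
derivatives of order `1 / √|A|` in the directions of `A`. -/
lemma sq_siteDiff_le_of_symmetric {f : Config n → ℝ} {C : ℝ} (hC : ∀ σ, gradSq f σ ≤ C)
    (A : Finset (Fin n)) (hA : ∀ i ∈ A, ∀ j ∈ A, ∀ σ, f (σ ∘ Equiv.swap i j) = f σ)
    {j : Fin n} (hj : j ∈ A) (σ : Config n) : A.card * siteDiff j f σ ^ 2 ≤ 2 * C := by
  have key : ∀ σ : Config n,
      ((A.filter fun i => σ i = σ j).card : ℝ) * siteDiff j f σ ^ 2 ≤ C := by
    intro σ
    refine le_trans ?_ (hC σ)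
    have : ∀ i ∈ A.filter (fun i => σ i = σ j), siteDiff i f σ ^ 2 = siteDiff j f σ ^ 2 := by
      intro i hi
      obtain ⟨hiA, hij⟩ := Finset.mem_filter.1 hi
      rw [sq_siteDiff_eq_flip, sq_siteDiff_eq_flip, ← flip_comp_swap hij, hA i hiA j hj]
    rw [← nsmul_eq_mul, ← Finset.sum_const, ← Finset.sum_congr rfl this]
    exact Finset.sum_le_univ_sum_of_nonneg fun i => sq_nonneg _
  have h1 := key σ
  have h2 := key (spinFlip σ j)
  rw [siteDiff_flip] at h2
  have hcard : A.card ≤ (A.filter fun i => σ i = σ j).card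
      + (A.filter fun i => spinFlip σ j i = spinFlip σ j j).card := by
    rw [← Finset.card_filter_add_card_filter_not (s := A) (fun i => σ i = σ j)]
    gcongr with i
    intro hne
    have hij : i ≠ j := fun h => hne (h ▸ rfl)
    simp only [spinFlip, Function.update_of_ne hij, Function.update_self]
    revert hne
    cases σ i <;> cases σ j <;> simp
  have hcard' : (A.card : ℝ) ≤ (A.filter fun i => σ i = σ j).card
      + (A.filter fun i => spinFlip σ j i = spinFlip σ j j).card := by exact_mod_cast hcard
  nlinarith [sq_nonneg (siteDiff j f σ)]

end Smoothing
/-! ### The Curie-Weiss measure -/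

section Measure

lemma cwExponent_eq (β : ℝ) (σ : Config n) :
    cwExponent β σ = β / (2 * n) * ((∑ i, spin σ i) ^ 2 - n) := by
  have hsq : (∑ i, spin σ i) ^ 2
      = 2 * (∑ i : Fin n, ∑ j : Fin n, if i < j then spin σ i * spin σ j else 0) + n := by
    have hsplit : ∀ i j : Fin n, spin σ i * spin σ j
        = (if i < j then spin σ i * spin σ j else 0)
          + (if j < i then spin σ j * spin σ i else 0) + if i = j then 1 else 0 := by
      intro i j
      have h1 : spin σ i * spin σ i = 1 := by rw [← abs_mul_abs_self, abs_spin, one_mul]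
      rcases lt_trichotomy i j with h | h | h
      · simp [h, h.ne, h.not_gt]
      · subst h; simp [h1]
      · simp [h, h.ne', h.not_gt, mul_comm]
    rw [sq, Finset.sum_mul_sum]
    rw [Finset.sum_congr rfl fun i _ => Finset.sum_congr rfl fun j _ => hsplit i j]
    simp only [Finset.sum_add_distrib]
    rw [Finset.sum_comm (f := fun i j => if j < i then spin σ j * spin σ i else 0)]
    simp
    ring
  rw [hsq, cwExponent]
  rcases Nat.eq_zero_or_pos n with rfl | hn
  · simp
  · field_simp
    ring

lemma cwMeasure_nonneg (β : ℝ) (σ : Config n) : 0 ≤ cwMeasure β n σ :=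
  div_nonneg (Real.exp_pos _).le (Finset.sum_nonneg fun _ _ => (Real.exp_pos _).le)

lemma sum_cwMeasure (β : ℝ) : ∑ σ, cwMeasure β n σ = 1 := by
  simp only [cwMeasure, ← Finset.sum_div]
  exact div_self (Finset.sum_pos (fun _ _ => Real.exp_pos _) Finset.univ_nonempty).ne'

lemma cwMeasure_comp_equiv (β : ℝ) (e : Equiv.Perm (Fin n)) (σ : Config n) :
    cwMeasure β n (σ ∘ e) = cwMeasure β n σ := by
  have : ∑ i, spin (σ ∘ e) i = ∑ i, spin σ i := Equiv.sum_comp e (spin σ)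
  rw [cwMeasure, cwMeasure, cwExponent_eq, cwExponent_eq, this]

lemma exp_eq_pPlus_mul (β s a : ℝ) :
    Real.exp (a + β * s) = pPlus β s * (Real.exp (a + β * s) + Real.exp (a - β * s)) := by
  have hc := (Real.cosh_pos (β * s)).ne'
  have hp := Real.exp_pos (β * s)
  have hm := Real.exp_pos (-(β * s))
  rw [pPlus, Real.tanh_eq_sinh_div_cosh, Real.sinh_eq, Real.cosh_eq, sub_eq_add_neg a,
    Real.exp_add, Real.exp_add]
  field_simp
  ring

/-- Conditional law of the spin at `i` under the Curie-Weiss measure. -/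
lemma cwMeasure_update_true (β : ℝ) (σ : Config n) (i : Fin n) :
    cwMeasure β n (Function.update σ i true) = siteProb β σ i
      * (cwMeasure β n (Function.update σ i true) + cwMeasure β n (Function.update σ i false)) := by
  have hn : (n : ℝ) ≠ 0 := (Nat.cast_pos.2 i.pos).ne'
  set m := ∑ j ∈ Finset.univ.erase i, spin σ j with hm
  have hsum : ∀ b, ∑ j, spin (Function.update σ i b) j = (if b then 1 else -1) + m := by
    intro b
    rw [← Finset.add_sum_erase _ _ (Finset.mem_univ i), spin, Function.update_self, hm]
    congr 1
    refine Finset.sum_congr rfl fun j hj => ?_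
    rw [spin, spin, Function.update_of_ne (Finset.ne_of_mem_erase hj)]
  have ht : cwExponent β (Function.update σ i true)
      = β / (2 * n) * (m ^ 2 + 1 - n) + β * (m / n) := by
    rw [cwExponent_eq, hsum, if_pos rfl]
    field_simp
    ring
  have hf : cwExponent β (Function.update σ i false)
      = β / (2 * n) * (m ^ 2 + 1 - n) - β * (m / n) := by
    rw [cwExponent_eq, hsum, if_neg (by simp)]
    field_simp
    ring
  rw [cwMeasure, cwMeasure, ht, hf, siteProb, mag_sub_spin, ← hm, ← add_div]
  exact (congrArg (· / _) (exp_eq_pPlus_mul β (m / n) _)).trans (mul_div_assoc _ _ _)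

lemma two_mul_sum_config (i : Fin n) (F : Config n → ℝ) :
    2 * ∑ σ, F σ = ∑ σ, (F (Function.update σ i true) + F (Function.update σ i false)) := by
  have hinv : Function.Involutive fun σ : Config n => spinFlip σ i := by
    intro σ
    simp [spinFlip]
  have h : ∑ σ, F (spinFlip σ i) = ∑ σ, F σ := Equiv.sum_comp hinv.toPerm F
  rw [two_mul]
  nth_rewrite 2 [← h]
  rw [← Finset.sum_add_distrib]
  refine Finset.sum_congr rfl fun σ _ => ?_
  have : F σ = F (Function.update σ i (σ i)) := by rw [Function.update_eq_self]
  rw [this, spinFlip]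
  cases σ i
  · simp [add_comm]
  · simp

lemma sum_cwMeasure_mul_heatBath (β : ℝ) (i : Fin n) (f : Config n → ℝ) :
    ∑ σ, cwMeasure β n σ * heatBath β i f σ = ∑ σ, cwMeasure β n σ * f σ := by
  refine mul_left_cancel₀ (two_ne_zero (α := ℝ)) ?_
  rw [two_mul_sum_config i, two_mul_sum_config i]
  refine Finset.sum_congr rfl fun σ _ => ?_
  have h := cwMeasure_update_true β σ i
  simp only [heatBath, siteProb_update_self, Function.update_idem]
  linear_combination (f (Function.update σ i false) - f (Function.update σ i true)) * h

lemma sum_cwMeasure_mul_markovOp (β : ℝ) (hn : 0 < n) (f : Config n → ℝ) :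
    ∑ σ, cwMeasure β n σ * markovOp β f σ = ∑ σ, cwMeasure β n σ * f σ := by
  have hn0 : (n : ℝ) ≠ 0 := by positivity
  calc ∑ σ, cwMeasure β n σ * markovOp β f σ
      = 1 / n * ∑ i : Fin n, ∑ σ, cwMeasure β n σ * heatBath β i f σ := by
        rw [Finset.sum_comm, Finset.mul_sum]
        refine Finset.sum_congr rfl fun σ _ => ?_
        rw [markovOp, ← Finset.mul_sum]
        ring
    _ = _ := by
        simp only [sum_cwMeasure_mul_heatBath, Finset.sum_const, Finset.card_univ,
          Fintype.card_fin, nsmul_eq_mul]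
        field_simp

lemma sum_cwMeasure_mul_iterate (β : ℝ) (hn : 0 < n) (t : ℕ) (f : Config n → ℝ) :
    ∑ σ, cwMeasure β n σ * (markovOp β)^[t] f σ = ∑ σ, cwMeasure β n σ * f σ := by
  induction t generalizing f with
  | zero => rfl
  | succ t ih => rw [Function.iterate_succ_apply, ih, sum_cwMeasure_mul_markovOp β hn]

end Measure

/-! ### Total variation bounds -/

section TotalVariation

lemma glauberLaw_eq_iterate (β : ℝ) (t : ℕ) (σ η : Config n) :
    glauberLaw β n t σ η = (markovOp β)^[t] (fun τ => if τ = η then 1 else 0) σ := by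
  rw [← sum_law_mul]
  simp

lemma glauberLaw_comp_equiv (β : ℝ) (t : ℕ) {σ : Config n} {e : Equiv.Perm (Fin n)}
    (he : σ ∘ e = σ) (η : Config n) :
    glauberLaw β n t σ (η ∘ e) = glauberLaw β n t σ η := by
  rw [glauberLaw_eq_iterate, glauberLaw_eq_iterate]
  nth_rewrite 1 [← he]
  rw [← markovOp_iterate_comp_equiv]
  simp only [e.surjective.injective_comp_right.eq_iff]

lemma exists_test_function {ν μ : Config n → ℝ} :
    ∃ f : Config n → ℝ, (∀ τ, |f τ| ≤ 1) ∧
      tvDist ν μ = (∑ τ, ν τ * f τ - ∑ τ, μ τ * f τ) / 2 ∧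
      ∀ τ τ', ν τ = ν τ' → μ τ = μ τ' → f τ = f τ' := by
  refine ⟨fun τ => if μ τ ≤ ν τ then 1 else -1, fun τ => ?_, ?_, fun τ τ' h1 h2 => ?_⟩
  · dsimp only
    split_ifs <;> simp
  · rw [tvDist, ← Finset.sum_sub_distrib]
    congr 1
    refine Finset.sum_congr rfl fun τ _ => ?_
    dsimp only
    split_ifs with h
    · rw [abs_of_nonneg (sub_nonneg.2 h)]
      ring
    · rw [abs_of_neg (sub_neg.2 (not_le.1 h))]
      ring
  · simp only [h1, h2]

lemma smoothConst_pos : 0 < smoothConst :=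
  div_pos (Real.exp_pos _) (pow_pos minProb_pos 2)

lemma sum_sqrt_class_le (σ : Config n) {C : ℝ} (hC : 0 ≤ C) :
    ∑ j, √(C / (Finset.univ.filter fun i => σ i = σ j).card) ≤ √(2 * C * n) := by
  refine Real.le_sqrt_of_sq_le ?_
  refine sq_sum_le_card_mul_sum_sq.trans ?_
  rw [Finset.card_univ, Fintype.card_fin, mul_comm]
  gcongr
  rw [← Finset.sum_fiberwise Finset.univ σ]
  have key : ∀ b : Bool, ∑ j ∈ Finset.univ.filter (fun j => σ j = b),
      √(C / (Finset.univ.filter fun i => σ i = σ j).card) ^ 2 ≤ C := by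
    intro b
    rw [Finset.sum_congr rfl (g := fun _ => C / (Finset.univ.filter fun i => σ i = b).card)]
    · rw [Finset.sum_const, nsmul_eq_mul]
      rcases Nat.eq_zero_or_pos (Finset.univ.filter fun i => σ i = b).card with h | h
      · simpa [h] using hC
      · rw [mul_div_cancel₀ _ (by positivity)]
    · intro j hj
      rw [Real.sq_sqrt (by positivity), (Finset.mem_filter.1 hj).2]
  refine (Finset.sum_le_sum fun b _ => key b).trans ?_
  simp

lemma tvDist_glauberLaw_le {β : ℝ} (hβ0 : 0 ≤ β) (hβ1 : β ≤ 1) {m : ℕ} (hm : m + 1 = n)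
    (t : ℕ) (σ : Config n) :
    tvDist (glauberLaw β n (t + m) σ) (cwMeasure β n)
      ≤ (1 - (1 - β) / n) ^ t * √(smoothConst * n) := by
  have hn : 0 < n := by omega
  obtain ⟨f, hf1, htv, hfsymm⟩ :=
    exists_test_function (ν := glauberLaw β n (t + m) σ) (μ := cwMeasure β n)
  set g := (markovOp β)^[m] f with hg
  have hgsymm : ∀ i j, σ i = σ j → ∀ τ, g (τ ∘ Equiv.swap i j) = g τ := by
    intro i j hij τ
    rw [hg, ← markovOp_iterate_comp_equiv, funext fun η => hfsymm _ _
      (glauberLaw_comp_equiv β _ (comp_swap_of_eq hij) η) (cwMeasure_comp_equiv β _ η)]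
  have hdiff : ∀ j τ, |siteDiff j g τ|
      ≤ √(2 * smoothConst / (Finset.univ.filter fun i => σ i = σ j).card) := by
    intro j τ
    have hcard : 0 < (Finset.univ.filter fun i => σ i = σ j).card :=
      Finset.card_pos.2 ⟨j, by simp⟩
    refine Real.abs_le_sqrt ?_
    rw [le_div_iff₀ (by exact_mod_cast hcard), mul_comm]
    refine sq_siteDiff_le_of_symmetric (gradSq_iterate_le hβ0 hβ1 hm hf1) _ ?_ (by simp) τ
    intro i hi k hk
    exact hgsymm i k ((Finset.mem_filter.1 hi).2.trans (Finset.mem_filter.1 hk).2.symm)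
  have hosc := abs_iterate_sub_le hβ0 hβ1 hn t hdiff
  set B := (1 - (1 - β) / n) ^ t
    * ∑ j, √(2 * smoothConst / (Finset.univ.filter fun i => σ i = σ j).card) with hB
  have hbound : (markovOp β)^[t] g σ - ∑ τ, cwMeasure β n τ * (markovOp β)^[t] g τ ≤ B := by
    have h1 : (markovOp β)^[t] g σ = ∑ τ, cwMeasure β n τ * (markovOp β)^[t] g σ := by
      rw [← Finset.sum_mul, sum_cwMeasure, one_mul]
    have h2 : B = ∑ τ, cwMeasure β n τ * B := by
      rw [← Finset.sum_mul, sum_cwMeasure, one_mul]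
    rw [h1, h2, ← Finset.sum_sub_distrib]
    refine Finset.sum_le_sum fun τ _ => ?_
    rw [← mul_sub]
    exact mul_le_mul_of_nonneg_left ((le_abs_self _).trans (hosc σ τ)) (cwMeasure_nonneg β τ)
  have hle1 : (1 - β) / (n : ℝ) ≤ 1 := by
    have : (1 : ℝ) ≤ n := by exact_mod_cast hn
    rw [div_le_one (by positivity)]
    linarith
  have hsqrt : √(2 * (2 * smoothConst) * n) = 2 * √(smoothConst * n) := by
    rw [show 2 * (2 * smoothConst) * (n : ℝ) = 2 ^ 2 * (smoothConst * n) by ring,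
      Real.sqrt_mul (by positivity), Real.sqrt_sq zero_le_two]
  have hB2 : B ≤ (1 - (1 - β) / n) ^ t * (2 * √(smoothConst * n)) := by
    rw [hB, ← hsqrt]
    exact mul_le_mul_of_nonneg_left
      (sum_sqrt_class_le σ (mul_nonneg zero_le_two smoothConst_pos.le))
      (pow_nonneg (sub_nonneg.2 hle1) t)
  rw [sum_cwMeasure_mul_iterate β hn, hg, sum_cwMeasure_mul_iterate β hn,
    ← Function.iterate_add_apply, ← sum_law_mul] at hbound
  rw [htv]
  linarith

lemma glauberDist_nonneg (β : ℝ) (n t : ℕ) : 0 ≤ glauberDist β n t :=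
  Real.iSup_nonneg fun _ =>
    div_nonneg (Finset.sum_nonneg fun _ _ => abs_nonneg _) zero_le_two

lemma glauberDist_cutoff_le {β γ : ℝ} (hβ0 : 0 ≤ β) (hβ1 : β < 1) (hγ : 1 ≤ γ) (hn : 0 < n) :
    glauberDist β n ⌈(n : ℝ) * Real.log n / (2 * (1 - β)) + γ * n⌉₊
      ≤ √smoothConst * Real.exp (-(1 - β) * (γ - 1)) := by
  have hn1 : (1 : ℝ) ≤ n := by exact_mod_cast hn
  have hn0 : (0 : ℝ) < n := by positivity
  have hβ : 0 < 1 - β := sub_pos.2 hβ1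
  have hlog : 0 ≤ (n : ℝ) * Real.log n / (2 * (1 - β)) :=
    div_nonneg (mul_nonneg hn0.le (Real.log_nonneg hn1)) (by positivity)
  set T := ⌈(n : ℝ) * Real.log n / (2 * (1 - β)) + γ * n⌉₊ with hT
  have hTle : (n : ℝ) * Real.log n / (2 * (1 - β)) + γ * n ≤ T := Nat.le_ceil _
  have hnT : n ≤ T := by
    have : (n : ℝ) ≤ T := by nlinarith
    exact_mod_cast this
  obtain ⟨m, hm⟩ : ∃ m, m + 1 = n := ⟨n - 1, by omega⟩
  obtain ⟨t, ht⟩ : ∃ t, T = t + m := ⟨T - m, by omega⟩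
  have htle : (n : ℝ) * Real.log n / (2 * (1 - β)) + (γ - 1) * n ≤ t := by
    have h1 : (T : ℝ) = t + m := by exact_mod_cast ht
    have h2 : (m : ℝ) + 1 = n := by exact_mod_cast hm
    linarith
  refine ciSup_le fun σ => ?_
  rw [ht]
  refine (tvDist_glauberLaw_le hβ0 hβ1.le hm t σ).trans ?_
  have hle1 : (1 - β) / (n : ℝ) ≤ 1 := by
    rw [div_le_one hn0]
    linarith
  have hpow : (1 - (1 - β) / (n : ℝ)) ^ t
      ≤ Real.exp (-(1 - β) * (γ - 1)) * Real.exp (-(Real.log n / 2)) := by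
    calc (1 - (1 - β) / (n : ℝ)) ^ t ≤ Real.exp (-((1 - β) / n)) ^ t :=
          pow_le_pow_left₀ (sub_nonneg.2 hle1) (Real.one_sub_le_exp_neg _) t
      _ = Real.exp (t * -((1 - β) / n)) := (Real.exp_nat_mul _ _).symm
      _ ≤ Real.exp (-(1 - β) * (γ - 1) + -(Real.log n / 2)) := by
          rw [Real.exp_le_exp]
          have h := mul_le_mul_of_nonneg_right htle (by positivity : 0 ≤ (1 - β) / (n : ℝ))
          have heq : ((n : ℝ) * Real.log n / (2 * (1 - β)) + (γ - 1) * n) * ((1 - β) / n)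
              = (1 - β) * (γ - 1) + Real.log n / 2 := by
            field_simp
            ring
          linarith
      _ = _ := Real.exp_add _ _
  have hsqrt : Real.exp (-(Real.log n / 2)) * √(n : ℝ) = 1 := by
    rw [Real.exp_neg, Real.exp_half, Real.exp_log hn0]
    exact inv_mul_cancel₀ (Real.sqrt_pos.2 hn0).ne'
  calc _ ≤ Real.exp (-(1 - β) * (γ - 1)) * Real.exp (-(Real.log n / 2))
        * √(smoothConst * n) := by gcongr
    _ = √smoothConst * Real.exp (-(1 - β) * (γ - 1))
        * (Real.exp (-(Real.log n / 2)) * √(n : ℝ)) := by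
        rw [Real.sqrt_mul smoothConst_pos.le]
        ring
    _ = _ := by rw [hsqrt, mul_one]

end TotalVariation

/-- Upper bound in the high-temperature cut-off: for `0 ≤ β < 1`,
`lim_{γ→∞} limsup_{n→∞} dₙ(n log n / (2(1-β)) + γn) = 0`. -/
theorem cw_cutoff_upper (β : ℝ) (hβ0 : 0 ≤ β) (hβ1 : β < 1) :
    Tendsto (fun γ : ℝ =>
        limsup (fun n : ℕ =>
          glauberDist β n ⌈(n : ℝ) * Real.log n / (2 * (1 - β)) + γ * n⌉₊) atTop)
      atTop (nhds 0) := by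
  have hbdd : ∀ γ : ℝ, 1 ≤ γ → ∀ᶠ n : ℕ in atTop,
      glauberDist β n ⌈(n : ℝ) * Real.log n / (2 * (1 - β)) + γ * n⌉₊
        ≤ √smoothConst * Real.exp (-(1 - β) * (γ - 1)) := fun γ hγ => by
    filter_upwards [eventually_gt_atTop 0] with n hn
    exact glauberDist_cutoff_le hβ0 hβ1 hγ hn
  have hlim : Tendsto (fun γ : ℝ => √smoothConst * Real.exp (-(1 - β) * (γ - 1)))
      atTop (nhds 0) := by
    rw [← mul_zero √smoothConst]
    refine Tendsto.const_mul _ (Real.tendsto_exp_atBot.comp ?_)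
    exact (tendsto_atTop_add_const_right _ (-1) tendsto_id).const_mul_atTop_of_neg
      (by linarith)
  refine tendsto_of_tendsto_of_tendsto_of_le_of_le' tendsto_const_nhds hlim ?_ ?_
  · filter_upwards [eventually_ge_atTop 1] with γ hγ
    refine le_limsup_of_frequently_le (Frequently.of_forall fun n => glauberDist_nonneg _ _ _) ?_
    exact isBoundedUnder_of_eventually_le (hbdd γ hγ)
  · filter_upwards [eventually_ge_atTop 1] with γ hγ
    refine limsup_le_of_le ?_ (hbdd γ hγ)
    exact isCoboundedUnder_le_of_le atTop fun n => glauberDist_nonneg _ _ _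

end

end CW
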